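/- arXiv:2206.10307 — 2 statements merged into one kernel-verified Lean document; each statement's English description precedes it below -/
import Mathlib

section
/- Let v ∈ ℝ^m be Diophantine: |k·v| ≥ ς/|k|^γ for all k ∈ ℤ^m \ {0}, with ς > 0, γ ≥ 0. Let g : 𝕋^m → ℂ be smooth with zero mean, ∫_{𝕋^m} g = 0. Then the function f defined by the Fourier series f(τ) = (2π)^{-m} Σ_{k ≠ 0} g_k/(i k·v) e^{ik·τ} is a well-defined smooth function on 𝕋^m satisfying the cohomological equation (v·∇)f = g. -/
open Finset MeasureTheory

def tbox (m : ℕ) : Set (Fin m → ℝ) := Set.univ.pi fun _ : Fin m => Set.Ioc (0:ℝ) (2 * Real.pi)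

def TPer {m : ℕ} (g : (Fin m → ℝ) → ℂ) : Prop :=
  ∀ (τ : Fin m → ℝ) (k : Fin m → ℤ), g (fun n => τ n + 2 * Real.pi * (k n : ℝ)) = g τ

noncomputable def tcf {m : ℕ} (g : (Fin m → ℝ) → ℂ) (k : Fin m → ℤ) : ℂ :=
  ∫ σ in tbox m, g σ * Complex.exp (-(Complex.I * ∑ n, (k n : ℂ) * (σ n : ℂ)))

noncomputable def tpd {m : ℕ} (n : Fin m) (g : (Fin m → ℝ) → ℂ) : (Fin m → ℝ) → ℂ :=
  fun x => fderiv ℝ g x (Pi.single n 1)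

lemma tbox_ae (m : ℕ) : (tbox m : Set (Fin m → ℝ)) =ᵐ[volume]
    Set.Icc (fun _ => (0:ℝ)) (fun _ => 2 * Real.pi) := by
  rw [volume_pi]
  exact Measure.univ_pi_Ioc_ae_eq_Icc

lemma tint {m : ℕ} {h : (Fin m → ℝ) → ℂ} (hc : Continuous h) : IntegrableOn h (tbox m) := by
  rw [integrableOn_congr_set_ae (tbox_ae m)]
  exact hc.continuousOn.integrableOn_compact isCompact_Icc

lemma tint_pd_zero {m : ℕ} (n : Fin m) {h : (Fin m → ℝ) → ℂ} (hs : ContDiff ℝ (⊤ : ℕ∞) h)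
    (hp : TPer h) : ∫ σ in tbox m, tpd n h σ = 0 := by
  obtain _ | m := m
  · exact n.elim0
  have hd : Differentiable ℝ h := hs.differentiable (by simp)
  have hcd : Continuous (tpd n h) := by
    have := hs.continuous_fderiv (by simp)
    unfold tpd
    fun_prop
  rw [setIntegral_congr_set (tbox_ae _)]
  have key := integral_divergence_of_hasFDerivAt_off_countable' (E := ℂ) (fun _ : Fin (m+1) => (0:ℝ))
    (fun _ => 2 * Real.pi) (fun _ => by positivity) (fun i => if i = n then h else 0)
    (fun i x => if i = n then fderiv ℝ h x else 0) ∅ Set.countable_empty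
    (by intro i; split_ifs
        · exact hs.continuous.continuousOn
        · exact continuousOn_const)
    (by intro x _ i; split_ifs
        · exact (hd x).hasFDerivAt
        · exact hasFDerivAt_const (0:ℂ) x)
  have e1 : (fun x => ∑ i, (if i = n then fderiv ℝ h x else 0) (Pi.single i (1:ℝ))) = tpd n h := by
    funext x
    rw [Finset.sum_eq_single n]
    · simp [tpd]
    · intro b _ hb; simp [hb]
    · simp
  have e2 := key (by rw [e1]; exact hcd.continuousOn.integrableOn_compact isCompact_Icc)
  rw [e1] at e2
  rw [e2]
  apply Finset.sum_eq_zero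
  intro i _
  split_ifs with hi
  · subst hi
    rw [sub_eq_zero]
    congr 1
    funext x
    rw [← hp (i.insertNth 0 x) (Pi.single i 1)]
    congr 1
    funext j
    refine Fin.succAboveCases i ?_ ?_ j
    · simp
    · intro j; simp [Fin.succAbove_ne]
  · simp

lemma tpd_smooth {m : ℕ} (n : Fin m) {h : (Fin m → ℝ) → ℂ} (hs : ContDiff ℝ (⊤ : ℕ∞) h) :
    ContDiff ℝ (⊤ : ℕ∞) (tpd n h) := by
  have : ContDiff ℝ (⊤ : ℕ∞) (fderiv ℝ h) := hs.fderiv_right (by simp)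
  exact this.clm_apply contDiff_const

lemma tpd_per {m : ℕ} (n : Fin m) {h : (Fin m → ℝ) → ℂ} (hp : TPer h) : TPer (tpd n h) := by
  intro τ k
  unfold tpd
  have : h = fun x => h (x + fun n => 2 * Real.pi * (k n : ℝ)) := by
    funext x; exact (hp x k).symm
  conv_rhs => rw [this, fderiv_comp_add_right]
  rfl

noncomputable def tL {m : ℕ} (k : Fin m → ℤ) : (Fin m → ℝ) →L[ℝ] ℝ :=
  ∑ n, (k n : ℝ) • ContinuousLinearMap.proj n

lemma tL_apply {m : ℕ} (k : Fin m → ℤ) (x : Fin m → ℝ) : tL k x = ∑ n, (k n : ℝ) * x n := by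
  simp [tL]

lemma tL_cast {m : ℕ} (k : Fin m → ℤ) (x : Fin m → ℝ) :
    (∑ n, (k n : ℂ) * (x n : ℂ)) = ((tL k x : ℝ) : ℂ) := by
  simp [tL_apply]

lemma tL_norm {m : ℕ} (k : Fin m → ℤ) : ‖tL k‖ ≤ m * ‖(fun n => (k n : ℝ))‖ := by
  refine ContinuousLinearMap.opNorm_le_bound _ (by positivity) fun x => ?_
  rw [tL_apply]
  refine (norm_sum_le _ _).trans ?_
  have : ∀ n ∈ (univ : Finset (Fin m)), ‖(k n : ℝ) * x n‖ ≤ ‖(fun n => (k n : ℝ))‖ * ‖x‖ := by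
    intro n _
    rw [norm_mul]
    gcongr
    · exact norm_le_pi_norm (fun n => (k n : ℝ)) n
    · exact norm_le_pi_norm x n
  refine (Finset.sum_le_sum this).trans ?_
  simp [mul_assoc]

lemma texp_per {m : ℕ} (k l : Fin m → ℤ) (τ : Fin m → ℝ) :
    Complex.exp (Complex.I * ((tL k (fun n => τ n + 2 * Real.pi * (l n : ℝ)) : ℝ) : ℂ))
     = Complex.exp (Complex.I * ((tL k τ : ℝ) : ℂ)) := by
  rw [Complex.exp_eq_exp_iff_exists_int]
  refine ⟨∑ n, k n * l n, ?_⟩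
  simp only [tL_apply]
  push_cast
  simp only [mul_add, Finset.sum_add_distrib, Finset.mul_sum, Finset.sum_mul]
  congr 1
  apply Finset.sum_congr rfl
  intro n _
  ring

lemma texp_neg {m : ℕ} (k : Fin m → ℤ) (τ : Fin m → ℝ) :
    -(Complex.I * ((tL k τ : ℝ) : ℂ)) = Complex.I * ((tL (-k) τ : ℝ) : ℂ) := by
  simp [tL_apply]

lemma texp_hasFDerivAt {m : ℕ} (k : Fin m → ℤ) (τ : Fin m → ℝ) :
    HasFDerivAt (fun τ => Complex.exp (Complex.I * ((tL k τ : ℝ) : ℂ)))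
      (Complex.exp (Complex.I * ((tL k τ : ℝ) : ℂ)) • (Complex.I • (Complex.ofRealCLM.comp (tL k)))) τ := by
  have h1 : HasFDerivAt (fun τ => ((tL k τ : ℝ) : ℂ)) (Complex.ofRealCLM.comp (tL k)) τ :=
    (Complex.ofRealCLM.comp (tL k)).hasFDerivAt
  exact (h1.const_mul Complex.I).cexp

lemma texp_contDiff {m : ℕ} (k : Fin m → ℤ) :
    ContDiff ℝ (⊤ : ℕ∞) (fun τ => Complex.exp (Complex.I * ((tL k τ : ℝ) : ℂ))) := by
  have : ContDiff ℝ (⊤ : ℕ∞) (fun τ => ((tL k τ : ℝ) : ℂ)) := (Complex.ofRealCLM.comp (tL k)).contDiff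
  exact (contDiff_const.mul this).cexp

lemma tcf_eq {m : ℕ} (g : (Fin m → ℝ) → ℂ) (k : Fin m → ℤ) :
    tcf g k = ∫ σ in tbox m, g σ * Complex.exp (Complex.I * ((tL (-k) σ : ℝ) : ℂ)) := by
  unfold tcf
  simp only [tL_cast, texp_neg]

lemma tcf_pd {m : ℕ} (n : Fin m) {g : (Fin m → ℝ) → ℂ} (hs : ContDiff ℝ (⊤ : ℕ∞) g)
    (hp : TPer g) (k : Fin m → ℤ) : tcf (tpd n g) k = Complex.I * (k n : ℂ) * tcf g k := by
  have h0 := tint_pd_zero n (hs.mul (texp_contDiff (-k)))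
    (by intro τ l; show g _ * _ = g _ * _; rw [hp τ l, texp_per])
  have e : tpd n (fun x => g x * Complex.exp (Complex.I * ((tL (-k) x : ℝ) : ℂ))) =
      fun x => tpd n g x * Complex.exp (Complex.I * ((tL (-k) x : ℝ) : ℂ)) -
        Complex.I * (k n : ℂ) * (g x * Complex.exp (Complex.I * ((tL (-k) x : ℝ) : ℂ))) := by
    funext x
    have hd : HasFDerivAt g (fderiv ℝ g x) x := (hs.differentiable (by simp) x).hasFDerivAt
    unfold tpd
    rw [(hd.fun_mul (texp_hasFDerivAt (-k) x)).fderiv]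
    have : tL (-k) (Pi.single n 1) = - (k n : ℝ) := by
      rw [tL_apply, Finset.sum_eq_single n]
      · simp
      · intro b _ hb; simp [hb]
      · simp
    simp [this]
    ring
  have hE := (texp_contDiff (-k)).continuous
  rw [e, integral_sub, integral_const_mul, sub_eq_zero] at h0
  · rw [tcf_eq, tcf_eq, h0]
  · exact tint ((tpd_smooth n hs).continuous.mul hE)
  · exact tint (continuous_const.mul (hs.continuous.mul hE))

lemma tcf_iter {m : ℕ} (n : Fin m) (N : ℕ) {g : (Fin m → ℝ) → ℂ} (hs : ContDiff ℝ (⊤ : ℕ∞) g)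
    (hp : TPer g) (k : Fin m → ℤ) : tcf ((tpd n)^[N] g) k = (Complex.I * (k n : ℂ)) ^ N * tcf g k := by
  induction N generalizing g with
  | zero => simp
  | succ N ih =>
    rw [Function.iterate_succ_apply, ih (tpd_smooth n hs) (tpd_per n hp), tcf_pd n hs hp]
    ring

lemma tcf_bound {m : ℕ} (g : (Fin m → ℝ) → ℂ) (k : Fin m → ℤ) :
    ‖tcf g k‖ ≤ ∫ σ in tbox m, ‖g σ‖ := by
  rw [tcf_eq]
  refine (norm_integral_le_integral_norm _).trans (le_of_eq ?_)
  congr 1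
  funext σ
  rw [norm_mul, mul_comm Complex.I, Complex.norm_exp_ofReal_mul_I, mul_one]

lemma tcf_decay {m : ℕ} {g : (Fin m → ℝ) → ℂ} (hs : ContDiff ℝ (⊤ : ℕ∞) g) (hp : TPer g) (N : ℕ) :
    ∃ C : ℝ, 0 ≤ C ∧ ∀ k : Fin m → ℤ, k ≠ 0 → ‖(fun n => (k n : ℝ))‖ ^ N * ‖tcf g k‖ ≤ C := by
  refine ⟨∑ n, ∫ σ in tbox m, ‖(tpd n)^[N] g σ‖, ?_, ?_⟩
  · exact Finset.sum_nonneg fun n _ => integral_nonneg fun _ => norm_nonneg _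
  intro k hk
  obtain ⟨n0, hn0⟩ := Function.ne_iff.1 hk
  have : Nonempty (Fin m) := ⟨n0⟩
  obtain ⟨n, hn⟩ := Finite.exists_max (fun n => ‖(k n : ℝ)‖)
  have : ‖(fun n => (k n : ℝ))‖ ≤ ‖(k n : ℝ)‖ := (pi_norm_le_iff_of_nonneg (norm_nonneg _)).2 hn
  calc _ ≤ ‖(k n : ℝ)‖ ^ N * ‖tcf g k‖ := by gcongr
    _ = ‖tcf ((tpd n)^[N] g) k‖ := by
      rw [tcf_iter n N hs hp]; simp
    _ ≤ _ := tcf_bound _ _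
    _ ≤ _ := Finset.single_le_sum (f := fun n => ∫ σ in tbox m, ‖(tpd n)^[N] g σ‖)
        (fun n _ => integral_nonneg fun _ => norm_nonneg _) (Finset.mem_univ n)

lemma tsummable_aux (m : ℕ) (L : Submodule ℤ (Fin m → ℝ)) [DiscreteTopology L]
    (hmem : ∀ k : Fin m → ℤ, (fun n => (k n : ℝ)) ∈ L) :
    ∃ N : ℕ, Summable fun k : Fin m → ℤ => ‖(fun n => (k n : ℝ))‖⁻¹ ^ N := by
  obtain ⟨N, hN⟩ := exists_gt (Module.finrank ℤ L)
  refine ⟨N, ?_⟩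
  have h := ZLattice.summable_norm_pow_inv L N hN
  let φ : (Fin m → ℤ) → L := fun k => ⟨fun n => (k n : ℝ), hmem k⟩
  have hφ : Function.Injective φ := by
    intro a b hab
    have h1 : (fun n => (a n : ℝ)) = fun n => (b n : ℝ) := congrArg Subtype.val hab
    funext j
    exact_mod_cast congrFun h1 j
  have h2 := h.comp_injective hφ
  have h3 : ((fun z : L => ‖z‖⁻¹ ^ N) ∘ φ) = fun k : Fin m → ℤ => ‖(fun n => (k n : ℝ))‖⁻¹ ^ N := by
    funext k
    simp only [Function.comp_apply, φ, Submodule.coe_norm]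
  rw [h3] at h2
  exact h2

lemma tsummable (m : ℕ) : ∃ N : ℕ, Summable fun k : Fin m → ℤ => ‖(fun n => (k n : ℝ))‖⁻¹ ^ N := by
  apply tsummable_aux m (Submodule.span ℤ (Set.range (Pi.basisFun ℝ (Fin m))))
  intro k
  have : (fun n => (k n : ℝ)) = ∑ n, k n • Pi.basisFun ℝ (Fin m) n := by
    funext j
    simp [Finset.sum_apply, Pi.single_apply]
  rw [this]
  exact Submodule.sum_mem _ fun n _ => Submodule.smul_mem _ _ (Submodule.subset_span ⟨n, rfl⟩)

lemma texp_iter {m : ℕ} (k : Fin m → ℤ) (N : ℕ) (a : ℂ) (x : Fin m → ℝ) :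
    ‖iteratedFDeriv ℝ N (fun τ => a * Complex.exp (Complex.I * ((tL k τ : ℝ) : ℂ))) x‖ ≤
      ‖a‖ * (m * ‖(fun n => (k n : ℝ))‖) ^ N := by
  have hE : ContDiff ℝ (⊤ : ℕ∞) (fun t : ℝ => Complex.exp (Complex.I * (t : ℂ))) :=
    (contDiff_const.mul Complex.ofRealCLM.contDiff).cexp
  have hid : iteratedDeriv N (fun t : ℝ => Complex.exp (Complex.I * (t : ℂ))) =
      fun t : ℝ => Complex.I ^ N * Complex.exp (Complex.I * (t : ℂ)) := by
    induction N with
    | zero => simp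
    | succ N ih =>
      rw [iteratedDeriv_succ, ih]
      funext t
      have h1 : HasDerivAt (fun t : ℝ => (t : ℂ)) 1 t := Complex.ofRealCLM.hasDerivAt
      have := ((h1.const_mul Complex.I).cexp.const_mul (Complex.I ^ N)).deriv
      rw [this]; ring
  have h2 : iteratedFDeriv ℝ N ((fun t : ℝ => Complex.exp (Complex.I * (t : ℂ))) ∘ tL k) x = _ :=
    (tL k).iteratedFDeriv_comp_right hE x (i := N) (by exact_mod_cast le_top)
  have h3 : iteratedFDeriv ℝ N (fun τ => a * Complex.exp (Complex.I * ((tL k τ : ℝ) : ℂ))) x =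
      a • iteratedFDeriv ℝ N ((fun t : ℝ => Complex.exp (Complex.I * (t : ℂ))) ∘ tL k) x := by
    have := iteratedFDeriv_const_smul_apply (𝕜 := ℝ) (i := N) (a := a) (x := x)
      (f := ((fun t : ℝ => Complex.exp (Complex.I * (t : ℂ))) ∘ tL k))
      (((texp_contDiff k).contDiffAt).of_le (by exact_mod_cast le_top))
    exact this
  rw [h3, h2, norm_smul]
  gcongr
  refine (ContinuousMultilinearMap.norm_compContinuousLinearMap_le _ _).trans ?_
  rw [norm_iteratedFDeriv_eq_norm_iteratedDeriv, hid]
  simp only [norm_mul, norm_pow, Complex.norm_I, one_pow, Finset.prod_const, Finset.card_univ,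
    Fintype.card_fin]
  rw [mul_comm Complex.I, Complex.norm_exp_ofReal_mul_I, one_mul, one_mul]
  gcongr
  exact tL_norm k

lemma tlift {m : ℕ} {g : (Fin m → ℝ) → ℂ} (hc : Continuous g) (hp : TPer g) :
    ∃ G : C(UnitAddTorus (Fin m), ℂ), ∀ x : Fin m → ℝ,
      G (fun i => (x i : UnitAddCircle)) = g (fun i => 2 * Real.pi * x i) := by
  have hq : IsOpenQuotientMap (fun (x : Fin m → ℝ) (i : Fin m) => (x i : UnitAddCircle)) :=
    IsOpenQuotientMap.piMap (fun _ => QuotientAddGroup.isOpenQuotientMap_mk)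
  let h : C(Fin m → ℝ, ℂ) := ⟨fun x => g (fun i => 2 * Real.pi * x i), by fun_prop⟩
  have hq' := hq.isQuotientMap
  let q : C(Fin m → ℝ, UnitAddTorus (Fin m)) := ⟨_, hq.continuous⟩
  have hfac : ∀ a b, q a = q b → h a = h b := by
    intro a b hab
    have : ∀ i, ∃ n : ℤ, a i = b i + n := by
      intro i
      have h1 : (a i : UnitAddCircle) = (b i : UnitAddCircle) := congrFun hab i
      rw [eq_comm, QuotientAddGroup.eq, AddSubgroup.mem_zmultiples_iff] at h1
      obtain ⟨n, hn⟩ := h1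
      refine ⟨n, ?_⟩
      simp at hn
      linarith
    choose l hl using this
    show g _ = g _
    refine Eq.trans ?_ (hp _ l)
    congr 1
    funext i
    rw [hl i]; ring
  have hq2 : Topology.IsQuotientMap q := hq'
  refine ⟨hq2.lift h hfac, fun x => ?_⟩
  have := hq2.lift_comp h hfac
  exact congrArg (fun F : C(Fin m → ℝ, ℂ) => F x) this

lemma tmF {m : ℕ} (k : Fin m → ℤ) (x : Fin m → ℝ) :
    UnitAddTorus.mFourier k (fun i => (x i : UnitAddCircle)) =
      Complex.exp (Complex.I * ((tL k (fun i => 2 * Real.pi * x i) : ℝ) : ℂ)) := by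
  simp only [UnitAddTorus.mFourier, ContinuousMap.coe_mk, fourier_coe_apply, ← Complex.exp_sum,
    tL_apply]
  congr 1
  push_cast
  rw [Finset.mul_sum]
  apply Finset.sum_congr rfl
  intro n _
  simp
  ring

open scoped Pointwise in
lemma tcoeff {m : ℕ} {g : (Fin m → ℝ) → ℂ} (G : C(UnitAddTorus (Fin m), ℂ))
    (hG : ∀ x : Fin m → ℝ, G (fun i => (x i : UnitAddCircle)) = g (fun i => 2 * Real.pi * x i))
    (k : Fin m → ℤ) :
    UnitAddTorus.mFourierCoeff G k = (2 * Real.pi : ℂ) ^ (-(m : ℤ)) * tcf g k := by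
  rw [UnitAddTorus.mFourierCoeff_eq_integral _ _ 0, tcf_eq]
  simp only [tmF, hG]
  have h := Measure.setIntegral_comp_smul_of_pos (volume : Measure (Fin m → ℝ))
    (fun σ => Complex.exp (Complex.I * ((tL (-k) σ : ℝ) : ℂ)) • g σ)
    (R := 2 * Real.pi) {x | ∀ i : Fin m, x i ∈ Set.Ioc ((0 : Fin m → ℝ) i) ((0 : Fin m → ℝ) i + 1)}
    (by positivity)
  refine Eq.trans ?_ (h.trans ?_)
  · rfl
  · have hb : (2 * Real.pi) • {x : Fin m → ℝ | ∀ i : Fin m, x i ∈ Set.Ioc ((0 : Fin m → ℝ) i) ((0 : Fin m → ℝ) i + 1)}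
        = tbox m := by
      have hpi : (0:ℝ) < 2 * Real.pi := by positivity
      ext x
      rw [Set.mem_smul_set_iff_inv_smul_mem₀ hpi.ne']
      simp only [tbox, Set.mem_setOf_eq, Set.mem_univ_pi, Set.mem_Ioc, Pi.smul_apply, Pi.zero_apply,
        smul_eq_mul, zero_add]
      refine forall_congr' fun i => ?_
      rw [inv_mul_le_iff₀ hpi, mul_one, mul_pos_iff_of_pos_left (inv_pos.2 hpi)]
    rw [hb]
    simp only [Module.finrank_fintype_fun_eq_card, Fintype.card_fin, smul_eq_mul]
    rw [Complex.real_smul]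
    congr 1
    · push_cast; simp
    · simp only [mul_comm]

lemma tinv {m : ℕ} {g : (Fin m → ℝ) → ℂ} (hc : Continuous g) (hp : TPer g)
    (hsum : Summable (tcf g)) (τ : Fin m → ℝ) :
    HasSum (fun k => (2 * Real.pi : ℂ) ^ (-(m : ℤ)) *
      (tcf g k * Complex.exp (Complex.I * ((tL k τ : ℝ) : ℂ)))) (g τ) := by
  obtain ⟨G, hG⟩ := tlift hc hp
  have h1 : Summable (UnitAddTorus.mFourierCoeff G) := by
    rw [funext (tcoeff G hG)]
    exact hsum.mul_left _
  have h2 := UnitAddTorus.hasSum_mFourier_series_apply_of_summable h1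
    (fun i => ((τ i / (2 * Real.pi) : ℝ) : UnitAddCircle))
  have e : (fun i => 2 * Real.pi * (τ i / (2 * Real.pi))) = τ := by
    funext i; field_simp
  rw [hG, e] at h2
  convert h2 using 2 with k
  rw [tmF, e, tcoeff G hG, smul_eq_mul, mul_assoc]

theorem stmt_5 (m : ℕ) (v : Fin m → ℝ)
    (ς γ : ℝ) (hς : 0 < ς) (hγ : 0 ≤ γ)
    (hdio : ∀ k : Fin m → ℤ, k ≠ 0 →
      ς / ‖(fun n => (k n : ℝ))‖ ^ γ ≤ |∑ n, (k n : ℝ) * v n|)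
    (g : (Fin m → ℝ) → ℂ) (hg : ContDiff ℝ (⊤ : ℕ∞) g)
    (hper : ∀ (τ : Fin m → ℝ) (k : Fin m → ℤ),
      g (fun n => τ n + 2 * Real.pi * (k n : ℝ)) = g τ)
    (hmean : (∫ τ in Set.univ.pi fun _ : Fin m => Set.Ioc (0:ℝ) (2 * Real.pi), g τ) = 0) :
    ∃ f : (Fin m → ℝ) → ℂ,
      ContDiff ℝ (⊤ : ℕ∞) f ∧
      (∀ (τ : Fin m → ℝ) (k : Fin m → ℤ),
        f (fun n => τ n + 2 * Real.pi * (k n : ℝ)) = f τ) ∧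
      (∀ τ : Fin m → ℝ, f τ =
        ((2 * Real.pi : ℂ)) ^ (-(m : ℤ)) *
          ∑' k : {k : Fin m → ℤ // k ≠ 0},
            (∫ σ in Set.univ.pi fun _ : Fin m => Set.Ioc (0:ℝ) (2 * Real.pi),
                g σ * Complex.exp (-(Complex.I * ∑ n, ((k : Fin m → ℤ) n : ℂ) * (σ n : ℂ))))
              / (Complex.I * ∑ n, ((k : Fin m → ℤ) n : ℂ) * (v n : ℂ))
              * Complex.exp (Complex.I * ∑ n, ((k : Fin m → ℤ) n : ℂ) * (τ n : ℂ))) ∧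
      (∀ τ : Fin m → ℝ, fderiv ℝ f τ v = g τ) := by
  have hP : TPer g := hper
  have hone : ∀ k : {k : Fin m → ℤ // k ≠ 0}, 1 ≤ ‖(fun n => (k.1 n : ℝ))‖ := by
    rintro ⟨k, hk⟩
    obtain ⟨n, hn⟩ := Function.ne_iff.1 hk
    refine le_trans ?_ (norm_le_pi_norm (fun n => (k n : ℝ)) n)
    rw [Real.norm_eq_abs]
    exact_mod_cast Int.one_le_abs hn
  let a : {k : Fin m → ℤ // k ≠ 0} → ℂ := fun k => tcf g k / (Complex.I * ((tL k.1 v : ℝ) : ℂ))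
  have hpos : ∀ k : {k : Fin m → ℤ // k ≠ 0}, 0 < |tL k.1 v| := by
    intro k
    rw [tL_apply]
    have := hone k
    exact lt_of_lt_of_le (by positivity) (hdio k.1 k.2)
  have ha : ∀ k, ‖a k‖ ≤ ς⁻¹ * (‖(fun n => (k.1 n : ℝ))‖ ^ ⌈γ⌉₊ * ‖tcf g k‖) := by
    intro k
    have h1 := hone k
    have h2 := hdio k.1 k.2
    rw [← tL_apply] at h2
    have h3 : ‖(fun n => (k.1 n : ℝ))‖ ^ γ ≤ ‖(fun n => (k.1 n : ℝ))‖ ^ ⌈γ⌉₊ := by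
      rw [← Real.rpow_natCast]
      exact Real.rpow_le_rpow_of_exponent_le h1 (Nat.le_ceil γ)
    simp only [a, norm_div, norm_mul, Complex.norm_I, one_mul, Complex.norm_real, Real.norm_eq_abs]
    rw [div_le_iff₀ (hpos k)]
    rw [div_le_iff₀ (by positivity)] at h2
    calc ‖tcf g k.1‖ = ς⁻¹ * (ς * ‖tcf g k.1‖) := by field_simp
      _ ≤ ς⁻¹ * ((|tL k.1 v| * ‖(fun n => (k.1 n : ℝ))‖ ^ ⌈γ⌉₊) * ‖tcf g k.1‖) := by
        gcongr
        exact h2.trans (by gcongr)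
      _ = _ := by ring
  obtain ⟨N, hN⟩ := tsummable m
  have hNs : Summable fun k : {k : Fin m → ℤ // k ≠ 0} => ‖(fun n => (k.1 n : ℝ))‖⁻¹ ^ N :=
    hN.comp_injective Subtype.val_injective
  have hcs : ∀ p : ℕ, Summable fun k : {k : Fin m → ℤ // k ≠ 0} =>
      ‖(fun n => (k.1 n : ℝ))‖ ^ p * ‖tcf g k‖ := by
    intro p
    obtain ⟨C, hC0, hC⟩ := tcf_decay hg hP (p + N)
    refine Summable.of_nonneg_of_le (fun k => by positivity) (fun k => ?_) (hNs.mul_left C)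
    have h1 := hone k
    have h2 := hC k.1 k.2
    rw [inv_pow, ← div_eq_mul_inv, le_div_iff₀ (by positivity)]
    refine le_trans (le_of_eq ?_) h2
    rw [pow_add]; ring
  have hbs : ∀ p : ℕ, Summable fun k : {k : Fin m → ℤ // k ≠ 0} =>
      ‖a k‖ * (m * ‖(fun n => (k.1 n : ℝ))‖) ^ p := by
    intro p
    refine Summable.of_nonneg_of_le (fun k => by positivity) (fun k => ?_)
      ((hcs (⌈γ⌉₊ + p)).mul_left (ς⁻¹ * (m : ℝ) ^ p))
    refine (mul_le_mul_of_nonneg_right (ha k) (by positivity)).trans (le_of_eq ?_)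
    rw [mul_pow, pow_add]; ring
  let F : {k : Fin m → ℤ // k ≠ 0} → (Fin m → ℝ) → ℂ := fun k τ =>
    a k * Complex.exp (Complex.I * ((tL k.1 τ : ℝ) : ℂ))
  have hFs : ∀ k, ContDiff ℝ (⊤ : ℕ∞) (F k) := fun k => contDiff_const.mul (texp_contDiff k.1)
  have hFd : ∀ k τ, HasFDerivAt (F k) (a k • (Complex.exp (Complex.I * ((tL k.1 τ : ℝ) : ℂ)) •
      (Complex.I • (Complex.ofRealCLM.comp (tL k.1))))) τ := fun k τ =>
    (texp_hasFDerivAt k.1 τ).const_mul (a k)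
  have hsm : ContDiff ℝ (⊤ : ℕ∞) (fun τ => ∑' k, F k τ) :=
    contDiff_tsum hFs (fun p _ => hbs p) (fun p k x _ => texp_iter k.1 p (a k) x)
  have hF0 : Summable fun k => F k 0 := by
    refine Summable.of_norm_bounded (hbs 0) fun k => ?_
    simp [F, tL_apply]
  have hfd : ∀ τ, HasFDerivAt (fun τ => ∑' k, F k τ) (∑' k, fderiv ℝ (F k) τ) τ := by
    intro τ
    refine hasFDerivAt_tsum (hbs 1) (fun k x => ((hFs k).differentiable (by simp) x).hasFDerivAt)
      (fun k x => ?_) hF0 τ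
    have := texp_iter k.1 1 (a k) x
    rwa [← norm_iteratedFDeriv_fderiv, norm_iteratedFDeriv_zero] at this
  have hfds : ∀ τ, Summable fun k => fderiv ℝ (F k) τ := by
    intro τ
    refine Summable.of_norm_bounded (hbs 1) fun k => ?_
    have := texp_iter k.1 1 (a k) τ
    rwa [← norm_iteratedFDeriv_fderiv, norm_iteratedFDeriv_zero] at this
  have hzero : tcf g 0 = 0 := by
    unfold tcf tbox
    simpa using hmean
  have hcsum : Summable (tcf g) := by
    have h1 : Summable fun k : {k : Fin m → ℤ // k ≠ 0} => tcf g k :=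
      Summable.of_norm (by simpa using hcs 0)
    refine (Function.Injective.summable_iff Subtype.val_injective ?_).1 h1
    intro k hk
    have : k = 0 := by
      by_contra h
      exact hk ⟨⟨k, h⟩, rfl⟩
    rw [this, hzero]
  have hinv := tinv hg.continuous hP hcsum
  refine ⟨fun τ => (2 * Real.pi : ℂ) ^ (-(m : ℤ)) * ∑' k, F k τ, contDiff_const.mul hsm, ?_, ?_, ?_⟩
  · intro τ l
    simp only [F, texp_per]
  · intro τ
    simp only [F, a, tL_cast, tcf, tbox]
  · intro τ
    rw [((hfd τ).const_mul _).fderiv]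
    rw [smul_apply]
    have h1 : (∑' k, fderiv ℝ (F k) τ) v = ∑' k, fderiv ℝ (F k) τ v :=
      (ContinuousLinearMap.apply ℝ ℂ v).map_tsum (hfds τ)
    rw [h1, smul_eq_mul, ← tsum_mul_left]
    have h2 : ∀ k : {k : Fin m → ℤ // k ≠ 0}, (2 * Real.pi : ℂ) ^ (-(m : ℤ)) * fderiv ℝ (F k) τ v =
        (2 * Real.pi : ℂ) ^ (-(m : ℤ)) *
          (tcf g k.1 * Complex.exp (Complex.I * ((tL k.1 τ : ℝ) : ℂ))) := by
      intro k
      rw [(hFd k τ).fderiv]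
      congr 1
      have : ((tL k.1 v : ℝ) : ℂ) ≠ 0 := by
        exact_mod_cast abs_pos.1 (hpos k)
      simp only [a, smul_apply, ContinuousLinearMap.comp_apply,
        Complex.ofRealCLM_apply, smul_eq_mul]
      field_simp
    rw [tsum_congr h2]
    refine HasSum.tsum_eq ?_
    refine (Function.Injective.hasSum_iff (f := fun k : Fin m → ℤ => (2 * Real.pi : ℂ) ^ (-(m : ℤ)) *
          (tcf g k * Complex.exp (Complex.I * ((tL k τ : ℝ) : ℂ)))) Subtype.val_injective ?_).2 (hinv τ)
    intro k hk
    have : k = 0 := by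
      by_contra h
      exact hk ⟨⟨k, h⟩, rfl⟩
    rw [this, hzero]
    simp
end

section
/- Let μ be a finite Borel measure on ℝ^{2d} invariant under the Hamiltonian flow φ_t^H of the harmonic oscillator, and let V be a smooth bounded function with average ⟨V⟩ = lim_{T→∞}(1/T)∫₀^T V∘φ_t^H dt (converging uniformly on compacts). Then for every compactly supported smooth function a, ∫ {V, ⟨a⟩} dμ = ∫ {⟨V⟩, ⟨a⟩} dμ, where ⟨a⟩ is the flow-average of a. -/
open Finset Filter MeasureTheory

/-- The Hamiltonian flow of the harmonic oscillator
`H = (1/2)Σ_j ω_j (ξ_j² + x_j²)`. -/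
noncomputable def flowH (d : ℕ) (ω : Fin d → ℝ) (t : ℝ)
    (z : (Fin d → ℝ) × (Fin d → ℝ)) : (Fin d → ℝ) × (Fin d → ℝ) :=
  (fun j => Real.cos (ω j * t) * z.1 j + Real.sin (ω j * t) * z.2 j,
   fun j => Real.cos (ω j * t) * z.2 j - Real.sin (ω j * t) * z.1 j)

/-- The Poisson bracket `{f,g} = Σ_j (∂_{ξ_j}f ∂_{x_j}g − ∂_{x_j}f ∂_{ξ_j}g)`. -/
noncomputable def poisson (d : ℕ)
    (f g : ((Fin d → ℝ) × (Fin d → ℝ)) → ℝ)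
    (z : (Fin d → ℝ) × (Fin d → ℝ)) : ℝ :=
  ∑ j, (fderiv ℝ f z ((0 : Fin d → ℝ), (Pi.single j 1 : Fin d → ℝ))
          * fderiv ℝ g z ((Pi.single j 1 : Fin d → ℝ), (0 : Fin d → ℝ))
      - fderiv ℝ f z ((Pi.single j 1 : Fin d → ℝ), (0 : Fin d → ℝ))
          * fderiv ℝ g z ((0 : Fin d → ℝ), (Pi.single j 1 : Fin d → ℝ)))

abbrev PS (d : ℕ) := (Fin d → ℝ) × (Fin d → ℝ)

lemma flowH_add (d : ℕ) (ω : Fin d → ℝ) (s t : ℝ) (z : PS d) :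
    flowH d ω t (flowH d ω s z) = flowH d ω (t + s) z := by
  ext j <;> simp only [flowH, mul_add, Real.cos_add, Real.sin_add] <;> ring

lemma flowH_zero (d : ℕ) (ω : Fin d → ℝ) (z : PS d) : flowH d ω 0 z = z := by
  ext j <;> simp [flowH]

noncomputable def flowL (d : ℕ) (ω : Fin d → ℝ) (t : ℝ) : PS d ≃L[ℝ] PS d :=
  LinearEquiv.toContinuousLinearEquiv
  { toFun := flowH d ω t
    invFun := flowH d ω (-t)
    map_add' := by intro x y; ext j <;> simp [flowH] <;> ring
    map_smul' := by intro c y; ext j <;> simp [flowH] <;> ring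
    left_inv := by intro z; rw [flowH_add]; simp [flowH_zero]
    right_inv := by intro z; rw [flowH_add]; simp [flowH_zero] }

lemma flowL_apply (d : ℕ) (ω : Fin d → ℝ) (t : ℝ) (z : PS d) :
    flowL d ω t z = flowH d ω t z := rfl

lemma norm_flowH_le (d : ℕ) (ω : Fin d → ℝ) (t : ℝ) (z : PS d) :
    ‖flowH d ω t z‖ ≤ 2 * ‖z‖ := by
  have h1 : ∀ j, |z.1 j| ≤ ‖z‖ := fun j => (norm_le_pi_norm z.1 j).trans (norm_fst_le z)
  have h2 : ∀ j, |z.2 j| ≤ ‖z‖ := fun j => (norm_le_pi_norm z.2 j).trans (norm_snd_le z)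
  have hp : ∀ c x : ℝ, |c| ≤ 1 → |x| ≤ ‖z‖ → |c * x| ≤ ‖z‖ := by
    intro c x hc hx
    rw [abs_mul]
    nlinarith [abs_nonneg c, abs_nonneg x]
  rw [Prod.norm_def]
  refine max_le ?_ ?_
  · refine (pi_norm_le_iff_of_nonneg (by positivity)).2 fun j => ?_
    simp only [flowH, Real.norm_eq_abs]
    refine (abs_add_le _ _).trans ?_
    linarith [hp _ _ (Real.abs_cos_le_one (ω j * t)) (h1 j), hp _ _ (Real.abs_sin_le_one (ω j * t)) (h2 j)]
  · refine (pi_norm_le_iff_of_nonneg (by positivity)).2 fun j => ?_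
    simp only [flowH, Real.norm_eq_abs]
    refine (abs_sub _ _).trans ?_
    linarith [hp _ _ (Real.abs_cos_le_one (ω j * t)) (h2 j), hp _ _ (Real.abs_sin_le_one (ω j * t)) (h1 j)]

lemma norm_le_flowH (d : ℕ) (ω : Fin d → ℝ) (t : ℝ) (z : PS d) :
    ‖z‖ ≤ 2 * ‖flowH d ω t z‖ := by
  have := norm_flowH_le d ω (-t) (flowH d ω t z)
  rwa [flowH_add, neg_add_cancel, flowH_zero] at this

lemma flowH_sub (d : ℕ) (ω : Fin d → ℝ) (t : ℝ) (z w : PS d) :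
    flowH d ω t z - flowH d ω t w = flowH d ω t (z - w) :=
  (map_sub (flowL d ω t) z w).symm

lemma flowH_map_add (d : ℕ) (ω : Fin d → ℝ) (t : ℝ) (z w : PS d) :
    flowH d ω t (z + w) = flowH d ω t z + flowH d ω t w :=
  (map_add (flowL d ω t) z w)

lemma continuous_flowH (d : ℕ) (ω : Fin d → ℝ) :
    Continuous (fun p : ℝ × PS d => flowH d ω p.1 p.2) := by
  unfold flowH; fun_prop

lemma fderiv_comp_flowH (d : ℕ) (ω : Fin d → ℝ) (t : ℝ) (f : PS d → ℝ) (z v : PS d) :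
    fderiv ℝ (fun w => f (flowH d ω t w)) z v = fderiv ℝ f (flowH d ω t z) (flowH d ω t v) := by
  have := (flowL d ω t).comp_right_fderiv (f := f) (x := z)
  have h2 : (f ∘ (flowL d ω t)) = (fun w => f (flowH d ω t w)) := rfl
  rw [h2] at this
  rw [this]; rfl

lemma flowH_e1 (d : ℕ) (ω : Fin d → ℝ) (t : ℝ) (j : Fin d) :
    flowH d ω t ((Pi.single j 1 : Fin d → ℝ), (0 : Fin d → ℝ)) =
      Real.cos (ω j * t) • ((Pi.single j 1 : Fin d → ℝ), (0 : Fin d → ℝ))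
      - Real.sin (ω j * t) • ((0 : Fin d → ℝ), (Pi.single j 1 : Fin d → ℝ)) := by
  ext i <;> by_cases h : i = j <;> simp [flowH, Pi.single_apply, h]

lemma flowH_e2 (d : ℕ) (ω : Fin d → ℝ) (t : ℝ) (j : Fin d) :
    flowH d ω t ((0 : Fin d → ℝ), (Pi.single j 1 : Fin d → ℝ)) =
      Real.sin (ω j * t) • ((Pi.single j 1 : Fin d → ℝ), (0 : Fin d → ℝ))
      + Real.cos (ω j * t) • ((0 : Fin d → ℝ), (Pi.single j 1 : Fin d → ℝ)) := by
  ext i <;> by_cases h : i = j <;> simp [flowH, Pi.single_apply, h]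

lemma poisson_comp (d : ℕ) (ω : Fin d → ℝ) (t : ℝ) (f g : PS d → ℝ) (z : PS d) :
    poisson d (fun w => f (flowH d ω t w)) (fun w => g (flowH d ω t w)) z
      = poisson d f g (flowH d ω t z) := by
  unfold poisson
  refine Finset.sum_congr rfl fun j _ => ?_
  simp only [fderiv_comp_flowH, flowH_e1, flowH_e2, map_add, map_sub, map_smul, smul_eq_mul]
  linear_combination (fderiv ℝ f (flowH d ω t z) (0, Pi.single j 1) *
    fderiv ℝ g (flowH d ω t z) (Pi.single j 1, 0) - fderiv ℝ f (flowH d ω t z) (Pi.single j 1, 0) *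
    fderiv ℝ g (flowH d ω t z) (0, Pi.single j 1)) * Real.sin_sq_add_cos_sq (ω j * t)

/-- the derivative of the averages -/
lemma tendsto_of_quadratic {E : Type*} [NormedAddCommGroup E] [NormedSpace ℝ E]
    [FiniteDimensional ℝ E] (F : ℝ → E → ℝ) (f : E → ℝ) (A : ℝ → E →L[ℝ] ℝ) (z : E) (C M : ℝ)
    (hF : ∀ w, Tendsto (fun T => F T w) atTop (nhds (f w)))
    (hA : ∀ T, 0 < T → ‖A T‖ ≤ M)
    (hq : ∀ T, 0 < T → ∀ h, ‖h‖ ≤ 1 → |F T (z + h) - F T z - A T h| ≤ C * ‖h‖ ^ 2) :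
    Tendsto A atTop (nhds (fderiv ℝ f z)) := by
  have hK : IsCompact (Metric.closedBall (0 : E →L[ℝ] ℝ) M) := isCompact_closedBall _ _
  refine hK.tendsto_nhds_of_unique_mapClusterPt ?_ ?_
  · filter_upwards [eventually_gt_atTop 0] with T hT
    simpa using hA T hT
  · intro B _ hB
    obtain ⟨U, hU, hUB⟩ := mapClusterPt_iff_ultrafilter.1 hB
    have hb : ∀ h : E, ‖h‖ ≤ 1 → |f (z + h) - f z - B h| ≤ C * ‖h‖ ^ 2 := by
      intro h hh
      have h1 : Tendsto (fun T => |F T (z + h) - F T z - A T h|) U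
          (nhds |f (z + h) - f z - B h|) := by
        refine Tendsto.abs ((((hF _).mono_left hU).sub ((hF _).mono_left hU)).sub ?_)
        exact ((ContinuousLinearMap.apply ℝ ℝ h).continuous.tendsto B).comp hUB
      refine le_of_tendsto h1 (hU ?_)
      filter_upwards [eventually_gt_atTop 0] with T hT using hq T hT h hh
    refine (HasFDerivAt.fderiv ?_).symm
    rw [hasFDerivAt_iff_isLittleO_nhds_zero]
    refine Asymptotics.IsBigO.trans_isLittleO (g := fun h : E => ‖h‖ ^ 2) ?_ ?_
    · refine Asymptotics.IsBigO.of_bound C ?_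
      filter_upwards [Metric.closedBall_mem_nhds (0 : E) one_pos] with h hh
      simpa using hb h (by simpa using hh)
    · exact Asymptotics.isLittleO_norm_pow_id one_lt_two

lemma taylor_ball {E : Type*} [NormedAddCommGroup E] [NormedSpace ℝ E]
    [FiniteDimensional ℝ E] (V : E → ℝ) (hV : ContDiff ℝ (⊤ : ℕ∞) V) (R : ℝ) :
    ∃ C, 0 ≤ C ∧ ∀ x h : E, ‖x‖ ≤ R → ‖x + h‖ ≤ R → |V (x + h) - V x - fderiv ℝ V x h| ≤ C * ‖h‖ ^ 2 := by
  have hd : ContDiff ℝ 1 (fderiv ℝ V) := hV.fderiv_right (by exact WithTop.coe_le_coe.2 le_top)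
  have hdd : Continuous (fderiv ℝ (fderiv ℝ V)) := hd.continuous_fderiv (by norm_num)
  obtain ⟨C, hC⟩ : ∃ C, ∀ x ∈ Metric.closedBall (0 : E) R, ‖fderiv ℝ (fderiv ℝ V) x‖ ≤ C :=
    (isCompact_closedBall (0 : E) R).exists_bound_of_continuousOn (f := fderiv ℝ (fderiv ℝ V)) hdd.continuousOn
  refine ⟨|C|, abs_nonneg _, fun x h hx hxh => ?_⟩
  have hcv : Convex ℝ (segment ℝ x (x + h)) := convex_segment _ _
  have hsub : segment ℝ x (x + h) ⊆ Metric.closedBall (0 : E) R :=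
    (convex_closedBall (0 : E) R).segment_subset (by simpa using hx) (by simpa using hxh)
  have hdist : ∀ y ∈ segment ℝ x (x + h), ‖y - x‖ ≤ ‖h‖ := by
    intro y hy
    have := norm_sub_le_of_mem_segment hy
    simpa using this
  have key : ∀ y ∈ segment ℝ x (x + h), ‖fderiv ℝ V y - fderiv ℝ V x‖ ≤ |C| * ‖h‖ := by
    intro y hy
    have h1 := hcv.norm_image_sub_le_of_norm_fderiv_le (f := fderiv ℝ V) (C := |C|)
      (fun u _ => (hd.differentiable (by norm_num)) u)
      (fun u hu => (hC u (hsub hu)).trans (le_abs_self C)) (left_mem_segment ℝ x (x + h)) hy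
    exact h1.trans (mul_le_mul_of_nonneg_left (hdist y hy) (abs_nonneg _))
  have h2 := hcv.norm_image_sub_le_of_norm_fderiv_le' (f := V) (φ := fderiv ℝ V x) (C := |C| * ‖h‖)
      (fun u _ => (hV.differentiable (by simp)) u) key (left_mem_segment ℝ x (x + h))
      (right_mem_segment ℝ x (x + h))
  simp only [add_sub_cancel_left, Real.norm_eq_abs] at h2
  nlinarith

lemma continuous_flowH_t (d : ℕ) (ω : Fin d → ℝ) (z : PS d) :
    Continuous (fun t : ℝ => flowH d ω t z) := by
  unfold flowH; fun_prop

lemma continuous_flowL (d : ℕ) (ω : Fin d → ℝ) :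
    Continuous (fun t : ℝ => (flowL d ω t : PS d →L[ℝ] PS d)) :=
  continuous_clm_apply.2 fun z => continuous_flowH_t d ω z

lemma norm_avg_le {E : Type*} [NormedAddCommGroup E] [NormedSpace ℝ E] (g : ℝ → E) (M T : ℝ)
    (hT : 0 < T) (hg : ∀ t, ‖g t‖ ≤ M) : ‖(1 / T) • ∫ t in (0:ℝ)..T, g t‖ ≤ M := by
  have h := intervalIntegral.norm_integral_le_of_norm_le_const (a := 0) (b := T) (f := g) (C := M)
    (fun t _ => hg t)
  rw [norm_smul, Real.norm_eq_abs, abs_of_pos (by positivity)]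
  rw [sub_zero, abs_of_pos hT] at h
  calc 1 / T * ‖∫ t in (0:ℝ)..T, g t‖ ≤ 1 / T * (M * T) := by gcongr
    _ = M := by field_simp

lemma fderiv_avg_tendsto (d : ℕ) (ω : Fin d → ℝ) (V Vavg : PS d → ℝ)
    (hV : ContDiff ℝ (⊤ : ℕ∞) V)
    (hF : ∀ z, Tendsto (fun (T : ℝ) => (1 / T) * ∫ t in (0:ℝ)..T, V (flowH d ω t z)) atTop
      (nhds (Vavg z))) (z v : PS d) :
    Tendsto (fun T : ℝ => (1 / T) * ∫ t in (0:ℝ)..T, fderiv ℝ V (flowH d ω t z) (flowH d ω t v))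
      atTop (nhds (fderiv ℝ Vavg z v)) := by
  have hd : Continuous (fderiv ℝ V) := hV.continuous_fderiv (by simp)
  have hVc : Continuous V := hV.continuous
  obtain ⟨C, hC0, hC⟩ := taylor_ball V hV (2 * (‖z‖ + 1))
  obtain ⟨M, hM⟩ : ∃ M, ∀ x ∈ Metric.closedBall (0 : PS d) (2 * (‖z‖ + 1)), ‖fderiv ℝ V x‖ ≤ M :=
    (isCompact_closedBall (0 : PS d) _).exists_bound_of_continuousOn (f := fderiv ℝ V) hd.continuousOn
  have hM' : ∀ t, ‖fderiv ℝ V (flowH d ω t z)‖ ≤ M := fun t => hM _ (by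
    have := norm_flowH_le d ω t z
    simp only [mem_closedBall_zero_iff]; linarith)
  let B : ℝ → PS d →L[ℝ] ℝ := fun t =>
    (fderiv ℝ V (flowH d ω t z)).comp (flowL d ω t : PS d →L[ℝ] PS d)
  have hB : Continuous B := (hd.comp (continuous_flowH_t d ω z)).clm_comp (continuous_flowL d ω)
  have hBapp : ∀ (T : ℝ) (h : PS d), ((1 / T) • ∫ t in (0:ℝ)..T, B t) h =
      (1 / T) * ∫ t in (0:ℝ)..T, fderiv ℝ V (flowH d ω t z) (flowH d ω t h) := by
    intro T h
    rw [smul_apply, ContinuousLinearMap.intervalIntegral_apply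
      (hB.intervalIntegrable _ _)]
    rfl
  have key := tendsto_of_quadratic
    (fun T z => (1 / T) * ∫ t in (0:ℝ)..T, V (flowH d ω t z)) Vavg
    (fun T => (1 / T) • ∫ t in (0:ℝ)..T, B t) z (C * 4) (M * 2) hF ?_ ?_
  · have := ((ContinuousLinearMap.apply ℝ ℝ v).continuous.tendsto _).comp key
    refine this.congr fun T => ?_
    exact hBapp T v
  · intro T hT
    refine norm_avg_le _ _ _ hT fun t => ?_
    refine (ContinuousLinearMap.opNorm_comp_le _ _).trans ?_
    have h2 : ‖(flowL d ω t : PS d →L[ℝ] PS d)‖ ≤ 2 :=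
      ContinuousLinearMap.opNorm_le_bound _ (by norm_num) fun w => norm_flowH_le d ω t w
    exact mul_le_mul (hM' t) h2 (norm_nonneg _) ((norm_nonneg _).trans (hM' t))
  · intro T hT h hh
    have hc : ∀ w, Continuous fun t => V (flowH d ω t w) :=
      fun w => hVc.comp (continuous_flowH_t d ω w)
    have hBh : Continuous fun t => fderiv ℝ V (flowH d ω t z) (flowH d ω t h) :=
      hB.clm_apply continuous_const
    have e : (1 / T) * (∫ t in (0:ℝ)..T, V (flowH d ω t (z + h)))
        - (1 / T) * (∫ t in (0:ℝ)..T, V (flowH d ω t z))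
        - ((1 / T) • ∫ t in (0:ℝ)..T, B t) h
        = (1 / T) • ∫ t in (0:ℝ)..T, (V (flowH d ω t (z + h)) - V (flowH d ω t z)
            - fderiv ℝ V (flowH d ω t z) (flowH d ω t h)) := by
      rw [hBapp, intervalIntegral.integral_sub, intervalIntegral.integral_sub, smul_eq_mul]
      · ring
      · exact (hc _).intervalIntegrable _ _
      · exact (hc _).intervalIntegrable _ _
      · exact ((hc _).sub (hc _)).intervalIntegrable _ _
      · exact hBh.intervalIntegrable _ _
    show |_ - _ - _| ≤ _
    rw [e, ← Real.norm_eq_abs]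
    refine norm_avg_le _ _ _ hT fun t => ?_
    have h1 := norm_flowH_le d ω t z
    have h2 := norm_flowH_le d ω t (z + h)
    have h3 := norm_add_le z h
    have h4 := norm_flowH_le d ω t h
    rw [flowH_map_add] at h2 ⊢
    rw [Real.norm_eq_abs]
    refine (hC _ _ (by linarith) (by linarith)).trans ?_
    have : ‖flowH d ω t h‖ ^ 2 ≤ (2 * ‖h‖) ^ 2 := by gcongr
    nlinarith

lemma avg_invariant (d : ℕ) (ω : Fin d → ℝ) (a aavg : PS d → ℝ) (hac : Continuous a) (C : ℝ)
    (hC : ∀ z, ‖a z‖ ≤ C)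
    (hF : ∀ z, Tendsto (fun (T : ℝ) => (1 / T) * ∫ t in (0:ℝ)..T, a (flowH d ω t z)) atTop
      (nhds (aavg z))) (s : ℝ) (z : PS d) : aavg (flowH d ω s z) = aavg z := by
  have h1 := (hF (flowH d ω s z)).sub (hF z)
  have hi : ∀ u v : ℝ, IntervalIntegrable (fun t => a (flowH d ω t z)) volume u v :=
    fun u v => (hac.comp (continuous_flowH_t d ω z)).intervalIntegrable _ _
  have h2 : Tendsto (fun T : ℝ => (1 / T) * (∫ t in (0:ℝ)..T, a (flowH d ω t (flowH d ω s z)))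
      - (1 / T) * ∫ t in (0:ℝ)..T, a (flowH d ω t z)) atTop (nhds 0) := by
    refine squeeze_zero_norm' (a := fun T : ℝ => (2 * C * |s|) * T⁻¹) ?_ ?_
    · filter_upwards [eventually_gt_atTop 0] with T hT
      have e : ∫ t in (0:ℝ)..T, a (flowH d ω t (flowH d ω s z))
          = ∫ t in (0 + s)..(T + s), a (flowH d ω t z) := by
        rw [← intervalIntegral.integral_comp_add_right (fun t => a (flowH d ω t z))]
        simp only [flowH_add]
      have e2 : (∫ t in (0 + s)..(T + s), a (flowH d ω t z)) - ∫ t in (0:ℝ)..T, a (flowH d ω t z)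
          = (∫ t in T..(T + s), a (flowH d ω t z)) - ∫ t in (0:ℝ)..s, a (flowH d ω t z) := by
        have i1 := intervalIntegral.integral_add_adjacent_intervals (hi 0 s) (hi s (T + s))
        have i2 := intervalIntegral.integral_add_adjacent_intervals (hi 0 T) (hi T (T + s))
        rw [zero_add]; linarith
      rw [← mul_sub, e, e2, norm_mul, Real.norm_eq_abs (1 / T), abs_of_pos (by positivity)]
      have b1 := intervalIntegral.norm_integral_le_of_norm_le_const (a := T) (b := T + s)
        (f := fun t => a (flowH d ω t z)) (C := C) (fun t _ => hC _)
      have b2 := intervalIntegral.norm_integral_le_of_norm_le_const (a := 0) (b := s)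
        (f := fun t => a (flowH d ω t z)) (C := C) (fun t _ => hC _)
      rw [add_sub_cancel_left] at b1
      rw [sub_zero] at b2
      rw [one_div, mul_comm]
      gcongr
      refine (norm_sub_le _ _).trans ?_
      linarith
    · simpa using tendsto_inv_atTop_zero.const_mul (2 * C * |s|)
  exact sub_eq_zero.1 (tendsto_nhds_unique h1 h2)

lemma measurable_poisson (d : ℕ) (f g : PS d → ℝ) : Measurable (poisson d f g) := by
  unfold poisson
  refine Finset.measurable_sum _ fun j _ => ?_
  exact ((measurable_fderiv_apply_const ℝ f _).mul (measurable_fderiv_apply_const ℝ g _)).sub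
    ((measurable_fderiv_apply_const ℝ f _).mul (measurable_fderiv_apply_const ℝ g _))

lemma poisson_bounded (d : ℕ) (ω : Fin d → ℝ) (V a aavg : PS d → ℝ)
    (hV : ContDiff ℝ (⊤ : ℕ∞) V) (ha : ContDiff ℝ (⊤ : ℕ∞) a) (hac : HasCompactSupport a)
    (hF : ∀ z, Tendsto (fun (T : ℝ) => (1 / T) * ∫ t in (0:ℝ)..T, a (flowH d ω t z)) atTop
      (nhds (aavg z))) : ∃ M, ∀ z, ‖poisson d V aavg z‖ ≤ M := by
  have hd : Continuous (fderiv ℝ V) := hV.continuous_fderiv (by simp)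
  obtain ⟨K, hK⟩ := ContDiff.lipschitzWith_of_hasCompactSupport hac ha (by simp)
  have hi : ∀ (z : PS d) (u v : ℝ), IntervalIntegrable (fun t => a (flowH d ω t z)) volume u v :=
    fun z u v => (ha.continuous.comp (continuous_flowH_t d ω z)).intervalIntegrable _ _
  have hL : LipschitzWith (K * 2) aavg := by
    refine LipschitzWith.of_dist_le_mul fun z w => ?_
    refine le_of_tendsto ((hF z).dist (hF w)) ?_
    filter_upwards [eventually_gt_atTop 0] with T hT
    rw [dist_eq_norm, ← mul_sub, ← intervalIntegral.integral_sub (hi _ _ _) (hi _ _ _), ← smul_eq_mul]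
    refine norm_avg_le _ _ _ hT fun t => ?_
    rw [← dist_eq_norm]
    refine (hK.dist_le_mul _ _).trans ?_
    rw [dist_eq_norm, dist_eq_norm, flowH_sub]
    have := norm_flowH_le d ω t (z - w)
    push_cast
    nlinarith [K.2]
  obtain ⟨R, hR⟩ := hac.isCompact.isBounded.subset_closedBall (0 : PS d)
  have hzero : ∀ z : PS d, 2 * R < ‖z‖ → aavg z = 0 := by
    intro z hz
    refine tendsto_nhds_unique (hF z) ?_
    have : ∀ t, a (flowH d ω t z) = 0 := by
      intro t
      refine image_eq_zero_of_notMem_tsupport fun hm => ?_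
      have h1 := hR hm
      have h2 := norm_le_flowH d ω t z
      rw [mem_closedBall_zero_iff] at h1
      linarith
    simp [this]
  have hfz : ∀ z : PS d, 2 * R < ‖z‖ → fderiv ℝ aavg z = 0 := by
    intro z hz
    have : aavg =ᶠ[nhds z] fun _ => 0 := by
      filter_upwards [(isOpen_lt continuous_const continuous_norm).mem_nhds hz] with w hw
        using hzero w hw
    rw [this.fderiv_eq]; simp
  obtain ⟨M, hM⟩ : ∃ M, ∀ x ∈ Metric.closedBall (0 : PS d) (2 * R), ‖fderiv ℝ V x‖ ≤ M :=
    (isCompact_closedBall (0 : PS d) _).exists_bound_of_continuousOn (f := fderiv ℝ V) hd.continuousOn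
  have hA : ∀ z, ‖fderiv ℝ aavg z‖ ≤ K * 2 := fun z => by
    have := norm_fderiv_le_of_lipschitz ℝ hL (x₀ := z)
    simpa using this
  have h1 : ∀ j : Fin d, ‖((Pi.single j 1 : Fin d → ℝ), (0 : Fin d → ℝ))‖ ≤ 1 := by
    intro j
    have : ‖(Pi.single j 1 : Fin d → ℝ)‖ ≤ 1 := by rw [Pi.norm_single]; simp
    simpa [Prod.norm_def] using this
  have h2 : ∀ j : Fin d, ‖((0 : Fin d → ℝ), (Pi.single j 1 : Fin d → ℝ))‖ ≤ 1 := by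
    intro j
    have : ‖(Pi.single j 1 : Fin d → ℝ)‖ ≤ 1 := by rw [Pi.norm_single]; simp
    simpa [Prod.norm_def] using this
  refine ⟨∑ _j : Fin d, (|M| * (K * 2) + |M| * (K * 2)), fun z => ?_⟩
  unfold poisson
  refine (norm_sum_le _ _).trans (Finset.sum_le_sum fun j _ => ?_)
  by_cases hz : ‖z‖ ≤ 2 * R
  · have hv : ∀ v : PS d, ‖v‖ ≤ 1 → ‖fderiv ℝ V z v‖ ≤ |M| := fun v hv =>
      ((fderiv ℝ V z).unit_le_opNorm v hv).trans ((hM z (by simpa using hz)).trans (le_abs_self M))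
    have hw : ∀ v : PS d, ‖v‖ ≤ 1 → ‖fderiv ℝ aavg z v‖ ≤ K * 2 := fun v hv =>
      ((fderiv ℝ aavg z).unit_le_opNorm v hv).trans (hA z)
    refine (norm_sub_le _ _).trans (add_le_add ?_ ?_)
    · rw [norm_mul]
      exact mul_le_mul (hv _ (h2 j)) (hw _ (h1 j)) (norm_nonneg _) (abs_nonneg _)
    · rw [norm_mul]
      exact mul_le_mul (hv _ (h1 j)) (hw _ (h2 j)) (norm_nonneg _) (abs_nonneg _)
  · rw [hfz z (not_le.1 hz)]
    simp only [zero_apply, mul_zero, sub_zero, norm_zero]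
    positivity

theorem stmt_9 (d : ℕ) (ω : Fin d → ℝ) (hω : ∀ j, 0 < ω j)
    (μ : Measure ((Fin d → ℝ) × (Fin d → ℝ))) [IsFiniteMeasure μ]
    (hinv : ∀ t : ℝ, Measure.map (flowH d ω t) μ = μ)
    (V Vavg : ((Fin d → ℝ) × (Fin d → ℝ)) → ℝ)
    (hV : ContDiff ℝ (⊤ : ℕ∞) V) (hVb : ∃ C, ∀ z, |V z| ≤ C)
    (hVavg : ∀ K : Set ((Fin d → ℝ) × (Fin d → ℝ)), IsCompact K →
      TendstoUniformlyOn
        (fun (T : ℝ) z => (1 / T) * ∫ t in (0:ℝ)..T, V (flowH d ω t z))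
        Vavg atTop K)
    (a aavg : ((Fin d → ℝ) × (Fin d → ℝ)) → ℝ)
    (ha : ContDiff ℝ (⊤ : ℕ∞) a) (hac : HasCompactSupport a)
    (haavg : ∀ K : Set ((Fin d → ℝ) × (Fin d → ℝ)), IsCompact K →
      TendstoUniformlyOn
        (fun (T : ℝ) z => (1 / T) * ∫ t in (0:ℝ)..T, a (flowH d ω t z))
        aavg atTop K) :
    ∫ z, poisson d V aavg z ∂μ = ∫ z, poisson d Vavg aavg z ∂μ := by
  have hFV : ∀ z, Tendsto (fun (T : ℝ) => (1 / T) * ∫ t in (0:ℝ)..T, V (flowH d ω t z)) atTop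
      (nhds (Vavg z)) := fun z =>
    (hVavg {z} isCompact_singleton).tendsto_at (Set.mem_singleton z)
  have hFa : ∀ z, Tendsto (fun (T : ℝ) => (1 / T) * ∫ t in (0:ℝ)..T, a (flowH d ω t z)) atTop
      (nhds (aavg z)) := fun z =>
    (haavg {z} isCompact_singleton).tendsto_at (Set.mem_singleton z)
  obtain ⟨Ca, hCa⟩ := hac.exists_bound_of_continuous ha.continuous
  have hinva := avg_invariant d ω a aavg ha.continuous Ca hCa hFa
  obtain ⟨M, hM⟩ := poisson_bounded d ω V a aavg hV ha hac hFa
  have hd : Continuous (fderiv ℝ V) := hV.continuous_fderiv (by simp)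
  have hmeas := measurable_poisson d V aavg
  have hG : ∀ t z, poisson d V aavg (flowH d ω t z)
      = poisson d (fun w => V (flowH d ω t w)) aavg z := by
    intro t z
    rw [← poisson_comp]
    simp only [hinva]
  -- averaged bracket converges pointwise
  have hlim : ∀ z, Tendsto (fun T : ℝ => (1 / T) * ∫ t in (0:ℝ)..T,
      poisson d V aavg (flowH d ω t z)) atTop (nhds (poisson d Vavg aavg z)) := by
    intro z
    have hc : ∀ v : PS d, Continuous fun t => fderiv ℝ V (flowH d ω t z) (flowH d ω t v) :=
      fun v => (hd.comp (continuous_flowH_t d ω z)).clm_apply (continuous_flowH_t d ω v)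
    have ht := fderiv_avg_tendsto d ω V Vavg hV hFV z
    have := tendsto_finsetSum (Finset.univ : Finset (Fin d)) (fun j _ =>
      ((ht ((0 : Fin d → ℝ), (Pi.single j 1 : Fin d → ℝ))).mul_const
        (fderiv ℝ aavg z ((Pi.single j 1 : Fin d → ℝ), (0 : Fin d → ℝ)))).sub
      ((ht ((Pi.single j 1 : Fin d → ℝ), (0 : Fin d → ℝ))).mul_const
        (fderiv ℝ aavg z ((0 : Fin d → ℝ), (Pi.single j 1 : Fin d → ℝ)))))
    refine this.congr fun T => ?_
    simp only [hG]
    simp only [poisson, fderiv_comp_flowH]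
    rw [intervalIntegral.integral_finsetSum, Finset.mul_sum]
    · refine Finset.sum_congr rfl fun j _ => ?_
      rw [intervalIntegral.integral_sub, intervalIntegral.integral_mul_const,
        intervalIntegral.integral_mul_const]
      · ring
      · exact ((hc _).mul continuous_const).intervalIntegrable _ _
      · exact ((hc _).mul continuous_const).intervalIntegrable _ _
    · intro j _
      exact (((hc _).mul continuous_const).sub ((hc _).mul continuous_const)).intervalIntegrable _ _
  have hjm : Measurable (fun p : ℝ × PS d => poisson d V aavg (flowH d ω p.1 p.2)) :=
    hmeas.comp (continuous_flowH d ω).measurable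
  -- dominated convergence
  have hdc : Tendsto (fun T : ℝ => ∫ z, (1 / T) * (∫ t in (0:ℝ)..T,
      poisson d V aavg (flowH d ω t z)) ∂μ) atTop (nhds (∫ z, poisson d Vavg aavg z ∂μ)) := by
    refine tendsto_integral_filter_of_dominated_convergence (fun _ => M) ?_ ?_
      (integrable_const M) (ae_of_all _ hlim)
    · filter_upwards [eventually_gt_atTop 0] with T hT
      simp only [intervalIntegral.integral_of_le hT.le]
      refine AEStronglyMeasurable.const_mul ?_ _
      exact (StronglyMeasurable.integral_prod_right (ν := volume.restrict (Set.Ioc 0 T))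
        (f := fun z t => poisson d V aavg (flowH d ω t z))
        (hjm.comp measurable_swap).stronglyMeasurable).aestronglyMeasurable
    · filter_upwards [eventually_gt_atTop 0] with T hT
      refine ae_of_all _ fun z => ?_
      rw [← smul_eq_mul]
      exact norm_avg_le _ _ _ hT fun t => hM _
  have hconst : ∀ T : ℝ, 0 < T → ∫ z, (1 / T) * (∫ t in (0:ℝ)..T,
      poisson d V aavg (flowH d ω t z)) ∂μ = ∫ z, poisson d V aavg z ∂μ := by
    intro T hT
    have hinv' : ∀ t, ∫ z, poisson d V aavg (flowH d ω t z) ∂μ = ∫ z, poisson d V aavg z ∂μ := by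
      intro t
      have hm : Measurable (flowH d ω t) := (flowL d ω t).continuous.measurable
      conv_rhs => rw [← hinv t]
      rw [integral_map hm.aemeasurable hmeas.aestronglyMeasurable]
    rw [integral_const_mul]
    simp only [intervalIntegral.integral_of_le hT.le]
    rw [integral_integral_swap]
    · simp only [hinv']
      simp [hT.le]
      field_simp
    · refine Integrable.of_bound (C := M) ?_ (ae_of_all _ fun p => hM _)
      exact (hjm.comp measurable_swap).aestronglyMeasurable
  refine tendsto_nhds_unique (Tendsto.congr' ?_ tendsto_const_nhds) hdc
  filter_upwards [eventually_gt_atTop 0] with T hT using (hconst T hT).symm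
end
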